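/- Let p, q be nonnegative integers and let (i_n)_{n≥0}, (j_n)_{n≥0} be sequences of nonnegative integers such that i_n + j_n = n for all n, i_n ≤ i_{n+1} for all n, and both i_n → ∞ and j_n → ∞ as n → ∞ (i.e., (i_n, j_n) is an infinite path in the Euler graph whose coordinates are unbounded). Define D_n = A_{p,q}(i_n − p, j_n − q) if i_n ≥ p and j_n ≥ q, and D_n = 0 otherwise. Then D_n / A_{0,0}(i_n, j_n) → 1/(p+q+1)! as n → ∞. In particular, the limit of dim(P,(i_n,j_n))/dim(R,(i_n,j_n)) exists for every such path and depends only on the level p+q of the vertex P = (p,q). -/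

import Mathlib

/-- The generalized Eulerian number `eulerA p q i j` counts the paths in the Euler graph
from `(p, q)` to `(p + i, q + j)`.  It is defined by the initial conditions
`eulerA p q i 0 = (q+1)^i`, `eulerA p q 0 j = (p+1)^j` and the recurrence
`eulerA p q i j = (j+q+1) * eulerA p q (i-1) j + (i+p+1) * eulerA p q i (j-1)`. -/
def eulerA (p q : ℕ) : ℕ → ℕ → ℕ
  | i, 0 => (q + 1) ^ i
  | 0, j + 1 => (p + 1) ^ (j + 1)
  | i + 1, j + 1 =>
      (j + 1 + q + 1) * eulerA p q i (j + 1) + (i + 1 + p + 1) * eulerA p q (i + 1) j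

theorem eulerA_zero_right (p q i : ℕ) : eulerA p q i 0 = (q + 1) ^ i := by
  cases i <;> simp [eulerA]

theorem eulerA_zero_left (p q j : ℕ) : eulerA p q 0 j = (p + 1) ^ j := by
  cases j <;> simp [eulerA]

theorem eulerA_rec (p q i j : ℕ) : eulerA p q (i + 1) (j + 1) =
    (j + 1 + q + 1) * eulerA p q i (j + 1) + (i + 1 + p + 1) * eulerA p q (i + 1) j := by
  simp [eulerA]

theorem eulerA_pos (p q i j : ℕ) : 0 < eulerA p q i j := by
  induction i generalizing j with
  | zero => rw [eulerA_zero_left]; positivity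
  | succ i ih =>
    cases j with
    | zero => rw [eulerA_zero_right]; positivity
    | succ j => rw [eulerA_rec]; have := ih (j + 1); positivity

/-- Paths from the two neighbours of a vertex differ by a lower-order quantity. -/
theorem eulerA_diff (p q i j : ℕ) :
    (eulerA p (q + 1) (i + 1) j : ℤ) - eulerA (p + 1) q i (j + 1)
      = eulerA p q (i + 1) j - eulerA p q i (j + 1) := by
  induction i generalizing j with
  | zero =>
    induction j with
    | zero => simp [eulerA]
    | succ j ih =>
      simp only [eulerA_rec, eulerA_zero_left] at ih ⊢
      push_cast at ih ⊢
      linear_combination ((p : ℤ) + 2) * ih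
  | succ i ihi =>
    induction j with
    | zero =>
      have h := ihi 0
      simp only [eulerA_rec, eulerA_zero_right] at h ⊢
      push_cast at h ⊢
      linear_combination ((q : ℤ) + 2) * h
    | succ j ih =>
      have h := ihi (j + 1)
      rw [eulerA_rec p (q + 1) (i + 1) j, eulerA_rec (p + 1) q i (j + 1),
        eulerA_rec p q (i + 1) j, eulerA_rec p q i (j + 1)]
      push_cast
      linear_combination ((j : ℤ) + q + 3) * h + ((i : ℤ) + p + 3) * ih

/-- First-step decomposition of paths. -/
theorem eulerA_first (p q i j : ℕ) :
    (eulerA p q (i + 1) (j + 1) : ℤ)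
      = (q + 1) * eulerA (p + 1) q i (j + 1) + (p + 1) * eulerA p (q + 1) (i + 1) j := by
  induction i generalizing j with
  | zero =>
    induction j with
    | zero => simp [eulerA]; ring
    | succ j ih =>
      rw [eulerA_rec p q 0 (j + 1), eulerA_rec p (q + 1) 0 j]
      simp only [eulerA_zero_left] at ih ⊢
      push_cast at ih ⊢
      linear_combination ((p : ℤ) + 2) * ih
  | succ i ihi =>
    induction j with
    | zero =>
      have h := ihi 0
      rw [eulerA_rec p q (i + 1) 0, eulerA_rec (p + 1) q i 0]
      simp only [eulerA_zero_right] at h ⊢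
      push_cast at h ⊢
      linear_combination ((q : ℤ) + 2) * h
    | succ j ih =>
      have h := ihi (j + 1)
      rw [eulerA_rec p q (i + 1) (j + 1), eulerA_rec p (q + 1) (i + 1) j,
        eulerA_rec (p + 1) q i (j + 1)]
      push_cast
      linear_combination ((j : ℤ) + q + 3) * h + ((i : ℤ) + p + 3) * ih

theorem eulerA_le_left (p q i j : ℕ) : eulerA (p + 1) q i j ≤ eulerA p q (i + 1) j := by
  cases j with
  | zero =>
    rw [eulerA_zero_right, eulerA_zero_right]
    exact Nat.pow_le_pow_right (by omega) (by omega)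
  | succ j =>
    have h := eulerA_first p q i j
    norm_cast at h
    rw [h]
    nlinarith [Nat.zero_le (q * eulerA (p + 1) q i (j + 1)),
      Nat.zero_le ((p + 1) * eulerA p (q + 1) (i + 1) j)]

theorem eulerA_le_right (p q i j : ℕ) : eulerA p (q + 1) i j ≤ eulerA p q i (j + 1) := by
  cases i with
  | zero =>
    rw [eulerA_zero_left, eulerA_zero_left]
    exact Nat.pow_le_pow_right (by omega) (by omega)
  | succ i =>
    have h := eulerA_first p q i j
    norm_cast at h
    rw [h]
    nlinarith [Nat.zero_le (p * eulerA p (q + 1) (i + 1) j),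
      Nat.zero_le ((q + 1) * eulerA (p + 1) q i (j + 1))]

theorem eulerA_le_root (p q i j : ℕ) : eulerA p q i j ≤ eulerA 0 0 (p + i) (q + j) := by
  induction p generalizing i with
  | zero =>
    induction q generalizing j with
    | zero => simp
    | succ q ih =>
      refine (eulerA_le_right 0 q i j).trans ((ih (j + 1)).trans_eq ?_)
      congr 1; omega
  | succ p ih =>
    refine (eulerA_le_left p q i j).trans ((ih (i + 1)).trans_eq ?_)
    congr 1; omega

/-- The ratio of path counts. -/
noncomputable def eulerRatio (p q : ℕ) (x : ℕ × ℕ) : ℝ :=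
  (eulerA p q (x.1 - p) (x.2 - q) : ℝ) / eulerA 0 0 x.1 x.2

open Filter in
theorem eulerRatio_diff (p q : ℕ) :
    Tendsto (fun x => eulerRatio p (q + 1) x - eulerRatio (p + 1) q x) atTop (nhds 0) := by
  have h1 : Tendsto (fun x : ℕ × ℕ => 1 / ((x.1 : ℝ) + 1)) atTop (nhds 0) := by
    rw [← prod_atTop_atTop_eq]
    exact tendsto_one_div_add_atTop_nhds_zero_nat.comp tendsto_fst
  have h2 : Tendsto (fun x : ℕ × ℕ => 1 / ((x.2 : ℝ) + 1)) atTop (nhds 0) := by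
    rw [← prod_atTop_atTop_eq]
    exact tendsto_one_div_add_atTop_nhds_zero_nat.comp tendsto_snd
  have h3 := h1.add h2
  rw [add_zero] at h3
  refine squeeze_zero_norm' ?_ h3
  filter_upwards [eventually_ge_atTop (p + 1, q + 1)] with x hx
  obtain ⟨a, b⟩ := x
  obtain ⟨ha, hb⟩ := Prod.mk_le_mk.mp hx
  obtain ⟨i, rfl⟩ := Nat.exists_eq_add_of_le ha
  obtain ⟨j, rfl⟩ := Nat.exists_eq_add_of_le hb
  have e1 : p + 1 + i - p = i + 1 := by omega
  have e2 : q + 1 + j - (q + 1) = j := by omega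
  have e3 : p + 1 + i - (p + 1) = i := by omega
  have e4 : q + 1 + j - q = j + 1 := by omega
  simp only [eulerRatio, e1, e2, e3, e4]
  have hd : (eulerA p (q + 1) (i + 1) j : ℝ) - eulerA (p + 1) q i (j + 1)
      = eulerA p q (i + 1) j - eulerA p q i (j + 1) := by
    exact_mod_cast eulerA_diff p q i j
  have hE : (0 : ℝ) < eulerA 0 0 (p + 1 + i) (q + 1 + j) := by
    exact_mod_cast eulerA_pos _ _ _ _
  have hr := eulerA_rec 0 0 (p + i) (q + j)
  have f1 : p + i + 1 = p + 1 + i := by omega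
  have f2 : q + j + 1 = q + 1 + j := by omega
  rw [f1, f2] at hr
  have b1 := eulerA_le_root p q (i + 1) j
  have b2 := eulerA_le_root p q i (j + 1)
  rw [show p + (i + 1) = p + 1 + i by omega] at b1
  rw [show q + (j + 1) = q + 1 + j by omega] at b2
  have c1 : (p + 1 + i + 1) * eulerA p q (i + 1) j ≤ eulerA 0 0 (p + 1 + i) (q + 1 + j) := by
    rw [hr]
    exact (Nat.mul_le_mul_left _ b1).trans (Nat.le_add_left _ _)
  have c2 : (q + 1 + j + 1) * eulerA p q i (j + 1) ≤ eulerA 0 0 (p + 1 + i) (q + 1 + j) := by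
    rw [hr]
    exact (Nat.mul_le_mul_left _ b2).trans (Nat.le_add_right _ _)
  have d1 : (eulerA p q (i + 1) j : ℝ) / eulerA 0 0 (p + 1 + i) (q + 1 + j)
      ≤ 1 / (((p + 1 + i : ℕ) : ℝ) + 1) := by
    rw [div_le_div_iff₀ hE (by positivity)]
    have : (((p + 1 + i : ℕ) : ℝ) + 1) * eulerA p q (i + 1) j
      ≤ eulerA 0 0 (p + 1 + i) (q + 1 + j) := by exact_mod_cast c1
    linarith
  have d2 : (eulerA p q i (j + 1) : ℝ) / eulerA 0 0 (p + 1 + i) (q + 1 + j)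
      ≤ 1 / (((q + 1 + j : ℕ) : ℝ) + 1) := by
    rw [div_le_div_iff₀ hE (by positivity)]
    have : (((q + 1 + j : ℕ) : ℝ) + 1) * eulerA p q i (j + 1)
      ≤ eulerA 0 0 (p + 1 + i) (q + 1 + j) := by exact_mod_cast c2
    linarith
  have n1 : (0 : ℝ) ≤ (eulerA p q (i + 1) j : ℝ) / eulerA 0 0 (p + 1 + i) (q + 1 + j) := by
    positivity
  have n2 : (0 : ℝ) ≤ (eulerA p q i (j + 1) : ℝ) / eulerA 0 0 (p + 1 + i) (q + 1 + j) := by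
    positivity
  rw [← sub_div, hd, sub_div, Real.norm_eq_abs, abs_le]
  constructor <;> linarith

open Filter in
theorem eulerRatio_first (p q : ℕ) : ∀ᶠ x in (atTop : Filter (ℕ × ℕ)),
    eulerRatio p q x = (q + 1) * eulerRatio (p + 1) q x + (p + 1) * eulerRatio p (q + 1) x := by
  filter_upwards [eventually_ge_atTop (p + 1, q + 1)] with x hx
  obtain ⟨a, b⟩ := x
  obtain ⟨ha, hb⟩ := Prod.mk_le_mk.mp hx
  obtain ⟨i, rfl⟩ := Nat.exists_eq_add_of_le ha
  obtain ⟨j, rfl⟩ := Nat.exists_eq_add_of_le hb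
  have e1 : p + 1 + i - p = i + 1 := by omega
  have e2 : q + 1 + j - (q + 1) = j := by omega
  have e3 : p + 1 + i - (p + 1) = i := by omega
  have e4 : q + 1 + j - q = j + 1 := by omega
  simp only [eulerRatio, e1, e2, e3, e4]
  have h : (eulerA p q (i + 1) (j + 1) : ℝ)
      = (q + 1) * eulerA (p + 1) q i (j + 1) + (p + 1) * eulerA p (q + 1) (i + 1) j := by
    exact_mod_cast eulerA_first p q i j
  rw [h]; ring

open Filter in
theorem eulerRatio_step (p q : ℕ)
    (h : Tendsto (eulerRatio p q) atTop (nhds (1 / (Nat.factorial (p + q + 1))))) :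
    Tendsto (eulerRatio (p + 1) q) atTop (nhds (1 / (Nat.factorial (p + q + 1 + 1)))) ∧
    Tendsto (eulerRatio p (q + 1)) atTop (nhds (1 / (Nat.factorial (p + q + 1 + 1)))) := by
  have hd := eulerRatio_diff p q
  have hp : (0 : ℝ) < (p : ℝ) + q + 2 := by positivity
  have hv : ∀ c : ℝ, (1 / (Nat.factorial (p + q + 1 + 1)) : ℝ)
      = (1 / (Nat.factorial (p + q + 1)) + c * 0) / ((p : ℝ) + q + 2) := by
    intro c
    have : (Nat.factorial (p + q + 1) : ℝ) ≠ 0 := by positivity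
    rw [Nat.factorial_succ (p + q + 1)]
    push_cast
    field_simp
    ring
  constructor
  · rw [hv (-((p : ℝ) + 1))]
    refine ((h.add (hd.const_mul (-((p : ℝ) + 1)))).div_const _).congr' ?_
    filter_upwards [eulerRatio_first p q] with x hx
    rw [hx]; field_simp; ring
  · rw [hv ((q : ℝ) + 1)]
    refine ((h.add (hd.const_mul ((q : ℝ) + 1))).div_const _).congr' ?_
    filter_upwards [eulerRatio_first p q] with x hx
    rw [hx]; field_simp; ring

open Filter in
theorem eulerRatio_tendsto (p q : ℕ) :
    Tendsto (eulerRatio p q) atTop (nhds (1 / (Nat.factorial (p + q + 1)))) := by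
  induction p with
  | zero =>
    induction q with
    | zero =>
      have : eulerRatio 0 0 = fun _ => 1 := by
        funext x
        have hE : (eulerA 0 0 x.1 x.2 : ℝ) ≠ 0 := by
          exact_mod_cast (eulerA_pos _ _ _ _).ne'
        simp [eulerRatio, hE]
      rw [this]
      simp
    | succ q ih => exact (eulerRatio_step 0 q ih).2
  | succ p ih =>
    have := (eulerRatio_step p q ih).1
    rwa [show p + 1 + q + 1 = p + q + 1 + 1 by omega]

theorem stmt13 (p q : ℕ) (i j : ℕ → ℕ)
    (hsum : ∀ n : ℕ, i n + j n = n)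
    (hmono : ∀ n : ℕ, i n ≤ i (n + 1))
    (hi : Filter.Tendsto i Filter.atTop Filter.atTop)
    (hj : Filter.Tendsto j Filter.atTop Filter.atTop)
    (D : ℕ → ℕ)
    (hD : ∀ n : ℕ, D n = if p ≤ i n ∧ q ≤ j n then eulerA p q (i n - p) (j n - q) else 0) :
    Filter.Tendsto (fun n : ℕ => (D n : ℝ) / (eulerA 0 0 (i n) (j n)))
      Filter.atTop (nhds (1 / (Nat.factorial (p + q + 1)))) := by
  have hx : Filter.Tendsto (fun n => (i n, j n)) Filter.atTop Filter.atTop := by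
    rw [← Filter.prod_atTop_atTop_eq]
    exact hi.prodMk hj
  refine ((eulerRatio_tendsto p q).comp hx).congr' ?_
  filter_upwards [hi.eventually_ge_atTop p, hj.eventually_ge_atTop q] with n h1 h2
  rw [hD, if_pos ⟨h1, h2⟩]
  rfl
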